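/- arXiv:2401.13564 — 9 statements merged into one kernel-verified Lean document; each statement's English description precedes it below -/
import Mathlib

section
/- Let ρ > 1, ŝ > 0, M > 0 and z ≥ 0 be real numbers with z ≤ M·ŝ·(ρ − 1/ρ). Then the detection error probability function ξ is nonincreasing on the interval (0, M·ŝ/ρ + z] and nondecreasing on the interval [M·ŝ/ρ + z, ∞). -/
open Real

/-- Detection error probability at the warden, as a function of the detection
threshold `Γ`, for noise-uncertainty level `ρ`, nominal noise power `s`,
number of antennas `M` and received signal power `z`. -/
noncomputable def detErrProb (ρ s M z Γ : ℝ) : ℝ :=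
  let L := max ((Γ - z) / M) (s / ρ)
  let U := min (Γ / M) (ρ * s)
  if L < U then 1 - (Real.log U - Real.log L) / (2 * Real.log ρ) else 1

/-- The detection error probability decreases when the ratio of the endpoints of the noise
interval increases. -/
theorem detErrProb_le_of_mul_le_mul {ρ s M z a b : ℝ} (hρ : 1 < ρ) (hs : 0 < s)
    (h : min (b / M) (ρ * s) * max ((a - z) / M) (s / ρ) ≤
      min (a / M) (ρ * s) * max ((b - z) / M) (s / ρ)) :
    detErrProb ρ s M z a ≤ detErrProb ρ s M z b := by
  have hlog : 0 < Real.log ρ := Real.log_pos hρ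
  have hsρ : 0 < s / ρ := div_pos hs (by linarith)
  have hLa : 0 < max ((a - z) / M) (s / ρ) := lt_max_of_lt_right hsρ
  have hLb : 0 < max ((b - z) / M) (s / ρ) := lt_max_of_lt_right hsρ
  simp only [detErrProb]
  generalize max ((a - z) / M) (s / ρ) = La at *
  generalize max ((b - z) / M) (s / ρ) = Lb at *
  generalize min (a / M) (ρ * s) = Ua at *
  generalize min (b / M) (ρ * s) = Ub at *
  by_cases hb : Lb < Ub
  · have hUb : 0 < Ub := hLb.trans hb
    have hUa : 0 < Ua := pos_of_mul_pos_left ((mul_pos hUb hLa).trans_le h) hLb.le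
    have ha : La < Ua := by nlinarith
    rw [if_pos ha, if_pos hb]
    have hl := Real.log_le_log (mul_pos hUb hLa) h
    rw [Real.log_mul hUb.ne' hLa.ne', Real.log_mul hUa.ne' hLb.ne'] at hl
    gcongr 1 - ?_ / _
    linarith
  · rw [if_neg hb]
    split_ifs with ha
    · have := Real.log_le_log hLa ha.le
      have : 0 ≤ (Real.log Ua - Real.log La) / (2 * Real.log ρ) :=
        div_nonneg (by linarith) (by linarith)
      linarith
    · exact le_rfl

theorem detErrProb_antitone_then_monotone
    (ρ s M z : ℝ) (hρ : 1 < ρ) (hs : 0 < s) (hM : 0 < M) (hz : 0 ≤ z)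
    (hzle : z ≤ M * s * (ρ - 1 / ρ)) :
    AntitoneOn (detErrProb ρ s M z) (Set.Ioc 0 (M * s / ρ + z)) ∧
      MonotoneOn (detErrProb ρ s M z) (Set.Ici (M * s / ρ + z)) := by
  have hsρ : 0 < s / ρ := div_pos hs (by linarith)
  have hthr : M * s / ρ = s / ρ * M := by ring
  rw [hthr]
  constructor
  · rintro a ⟨_, ha⟩ b ⟨_, hb⟩ hab
    apply detErrProb_le_of_mul_le_mul hρ hs
    have hLa : (a - z) / M ≤ s / ρ := by rw [div_le_iff₀ hM]; linarith
    have hLb : (b - z) / M ≤ s / ρ := by rw [div_le_iff₀ hM]; linarith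
    rw [max_eq_right hLa, max_eq_right hLb]
    gcongr
  · intro a ha b hb hab
    rw [Set.mem_Ici] at ha hb
    apply detErrProb_le_of_mul_le_mul hρ hs
    have hLa : s / ρ ≤ (a - z) / M := by rw [le_div_iff₀ hM]; linarith
    have hLb : s / ρ ≤ (b - z) / M := by rw [le_div_iff₀ hM]; linarith
    rw [max_eq_left hLa, max_eq_left hLb, min_mul_of_nonneg _ _ (hsρ.le.trans hLa),
      min_mul_of_nonneg _ _ (hsρ.le.trans hLb)]
    apply min_le_min
    · rw [div_mul_div_comm, div_mul_div_comm]
      gcongr ?_ / _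
      nlinarith
    · have : 0 < ρ * s := mul_pos (by linarith) hs
      gcongr
end

section
/- Let ρ > 1, ŝ > 0, M > 0 and z ≥ 0 be real numbers with z ≤ M·ŝ·(ρ − 1/ρ), and set Γ* = M·ŝ/ρ + z. Then for every Γ > 0 one has ξ(Γ) ≥ ξ(Γ*), and the minimal detection error probability equals ξ(Γ*) = 1 − ln(1 + ρ·z/(M·ŝ))/(2·ln ρ). Moreover Γ* = min(M·ŝ/ρ + z, ρ·M·ŝ). -/
open Real

/-- At the threshold `M * s / ρ + z` the detection error probability has a closed form. -/
lemma detErrProb_optimal {ρ s M z : ℝ} (hρ : 1 < ρ) (hs : 0 < s) (hM : 0 < M) (hz : 0 ≤ z)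
    (hzle : M * s / ρ + z ≤ ρ * M * s) :
    detErrProb ρ s M z (M * s / ρ + z)
      = 1 - Real.log (1 + ρ * z / (M * s)) / (2 * Real.log ρ) := by
  have hρ0 : 0 < ρ := by linarith
  have hL : (M * s / ρ + z - z) / M = s / ρ := by field_simp; ring
  have hU : (M * s / ρ + z) / M = s / ρ * (1 + ρ * z / (M * s)) := by field_simp
  have hmin : (M * s / ρ + z) / M ≤ ρ * s := by
    rw [div_le_iff₀ hM]; linarith
  rw [hU] at hmin
  have hlog : Real.log (s / ρ * (1 + ρ * z / (M * s)))
      = Real.log (s / ρ) + Real.log (1 + ρ * z / (M * s)) :=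
    Real.log_mul (by positivity) (by positivity)
  simp only [detErrProb, hL, max_self, hU, min_eq_left hmin, hlog]
  split_ifs with h
  · ring
  · have hz0 : ρ * z / (M * s) = 0 := by
      refine le_antisymm ?_ (by positivity)
      have hsρ : 0 < s / ρ := by positivity
      nlinarith
    simp [hz0]

/-- A lower bound on the detection error probability, uniform in the threshold. -/
lemma le_detErrProb {ρ s M z : ℝ} (hρ : 1 < ρ) (hs : 0 < s) (hM : 0 < M) (hz : 0 ≤ z) (Γ : ℝ) :
    1 - Real.log (1 + ρ * z / (M * s)) / (2 * Real.log ρ) ≤ detErrProb ρ s M z Γ := by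
  have hρ0 : 0 < ρ := by linarith
  have hlogρ : 0 < Real.log ρ := Real.log_pos hρ
  have hq : 0 ≤ ρ * z / (M * s) := by positivity
  simp only [detErrProb]
  set L := max ((Γ - z) / M) (s / ρ) with hL
  set U := min (Γ / M) (ρ * s) with hU
  split_ifs with h
  · have hsL : s / ρ ≤ L := le_max_right _ _
    have hL0 : 0 < L := lt_of_lt_of_le (by positivity) hsL
    have hUL : U ≤ L * (1 + ρ * z / (M * s)) := by
      calc U ≤ Γ / M := min_le_left _ _
        _ = (Γ - z) / M + s / ρ * (ρ * z / (M * s)) := by field_simp; ring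
        _ ≤ L + L * (ρ * z / (M * s)) :=
          add_le_add (le_max_left _ _) (mul_le_mul_of_nonneg_right hsL hq)
        _ = L * (1 + ρ * z / (M * s)) := by ring
    have hlog := Real.log_le_log (hL0.trans h) hUL
    rw [Real.log_mul hL0.ne' (by positivity)] at hlog
    gcongr
    linarith
  · have := Real.log_nonneg (show 1 ≤ 1 + ρ * z / (M * s) by linarith)
    exact sub_le_self _ (by positivity)

theorem optimal_threshold_and_min_DEP
    (ρ s M z : ℝ) (hρ : 1 < ρ) (hs : 0 < s) (hM : 0 < M) (hz : 0 ≤ z)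
    (hzle : z ≤ M * s * (ρ - 1 / ρ)) :
    (∀ Γ : ℝ, 0 < Γ →
        detErrProb ρ s M z (M * s / ρ + z) ≤ detErrProb ρ s M z Γ) ∧
    detErrProb ρ s M z (M * s / ρ + z)
        = 1 - Real.log (1 + ρ * z / (M * s)) / (2 * Real.log ρ) ∧
    M * s / ρ + z = min (M * s / ρ + z) (ρ * M * s) := by
  have hρ0 : 0 < ρ := by linarith
  have hle : M * s / ρ + z ≤ ρ * M * s := by
    have : M * s * (ρ - 1 / ρ) = ρ * M * s - M * s / ρ := by ring
    linarith
  have hopt := detErrProb_optimal hρ hs hM hz hle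
  exact ⟨fun Γ _ => hopt.le.trans (le_detErrProb hρ hs hM hz Γ), hopt, (min_eq_left hle).symm⟩
end

section
/- Let H be an m×n complex matrix, W an n×l complex matrix, σ > 0 a real, and Ψ an l×l positive semidefinite Hermitian complex matrix. For an m×l complex matrix U define the MSE matrix E(U) = (I_l − Uᴴ·H·W)·(I_l − Uᴴ·H·W)ᴴ + σ²·Uᴴ·U. Let R = H·W·Wᴴ·Hᴴ + σ²·I_m (which is positive definite, hence invertible) and U* = R⁻¹·H·W. Then for every m×l complex matrix U, Re(Tr(Ψ·E(U*))) ≤ Re(Tr(Ψ·E(U))); i.e., U* is the linear receive beamformer minimizing the weighted mean-square error. -/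
open Matrix
open scoped ComplexOrder

open scoped MatrixOrder Matrix.Norms.L2Operator in
theorem Matrix.PosSemidef.trace_mul_nonneg {k : Type*} [Fintype k] [DecidableEq k]
    {A B : Matrix k k ℂ} (hA : A.PosSemidef) (hB : B.PosSemidef) : 0 ≤ (A * B).trace := by
  obtain ⟨C, rfl⟩ := CStarAlgebra.nonneg_iff_eq_star_mul_self.mp hA.nonneg
  rw [star_eq_conjTranspose, Matrix.mul_assoc, Matrix.trace_mul_comm]
  exact (hB.mul_mul_conjTranspose_same C).trace_nonneg

/-- Completing the square in the mean-square error matrix around a solution of the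
normal equations `(G * Gᴴ + c • 1) * V = G`. -/
theorem Matrix.mse_eq_add_of_normal_equation {m l : Type*} [Fintype m] [Fintype l] [DecidableEq m]
    [DecidableEq l] {G V : Matrix m l ℂ} {c : ℂ}
    (hR : (G * Gᴴ + c • (1 : Matrix m m ℂ)).IsHermitian)
    (hV : (G * Gᴴ + c • (1 : Matrix m m ℂ)) * V = G) (U : Matrix m l ℂ) :
    (1 - Uᴴ * G) * (1 - Uᴴ * G)ᴴ + c • (Uᴴ * U) =
      (1 - Vᴴ * G) * (1 - Vᴴ * G)ᴴ + c • (Vᴴ * V) +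
        (U - V)ᴴ * (G * Gᴴ + c • (1 : Matrix m m ℂ)) * (U - V) := by
  have expand (X : Matrix m l ℂ) : (1 - Xᴴ * G) * (1 - Xᴴ * G)ᴴ + c • (Xᴴ * X) =
      1 - Xᴴ * G - Gᴴ * X + Xᴴ * ((G * Gᴴ + c • (1 : Matrix m m ℂ)) * X) := by
    simp only [conjTranspose_sub, conjTranspose_one, conjTranspose_mul, conjTranspose_conjTranspose,
      Matrix.mul_sub, Matrix.sub_mul, Matrix.add_mul, Matrix.mul_add, Matrix.mul_one,
      Matrix.one_mul, Matrix.mul_assoc, Matrix.smul_mul, Matrix.mul_smul]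
    abel
  have hV' : Vᴴ * (G * Gᴴ + c • (1 : Matrix m m ℂ)) = Gᴴ := by
    simpa only [conjTranspose_mul, hR.eq] using congrArg conjTranspose hV
  rw [expand U, expand V, hV, conjTranspose_sub, Matrix.sub_mul, hV', Matrix.mul_sub,
    Matrix.sub_mul, Matrix.sub_mul, Matrix.mul_assoc Uᴴ _ V, hV, Matrix.mul_assoc Uᴴ _ U]
  have hGV : Vᴴ * G = Gᴴ * V := by
    rw [← hV', Matrix.mul_assoc, hV]
  rw [hGV]
  abel

theorem mmse_receiver_optimal
    {m n l : ℕ} (H : Matrix (Fin m) (Fin n) ℂ) (W : Matrix (Fin n) (Fin l) ℂ)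
    (σ : ℝ) (hσ : 0 < σ)
    (Ψ : Matrix (Fin l) (Fin l) ℂ) (hΨ : Ψ.PosSemidef) :
    let E : Matrix (Fin m) (Fin l) ℂ → Matrix (Fin l) (Fin l) ℂ := fun U =>
      (1 - Uᴴ * (H * W)) * (1 - Uᴴ * (H * W))ᴴ + ((σ : ℂ) ^ 2) • (Uᴴ * U)
    let R : Matrix (Fin m) (Fin m) ℂ :=
      H * W * Wᴴ * Hᴴ + ((σ : ℂ) ^ 2) • (1 : Matrix (Fin m) (Fin m) ℂ)
    let Ustar : Matrix (Fin m) (Fin l) ℂ := R⁻¹ * (H * W)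
    R.PosDef ∧
      ∀ U : Matrix (Fin m) (Fin l) ℂ,
        (Ψ * E Ustar).trace.re ≤ (Ψ * E U).trace.re := by
  intro E R Ustar
  have hR_eq : R = H * W * (H * W)ᴴ + ((σ : ℂ) ^ 2) • (1 : Matrix (Fin m) (Fin m) ℂ) := by
    simp only [R, conjTranspose_mul, Matrix.mul_assoc]
  have hc : (0 : ℂ) < (σ : ℂ) ^ 2 := by exact_mod_cast pow_pos hσ 2
  have hR : R.PosDef := hR_eq ▸
    (PosDef.one.smul hc).posSemidef_add (posSemidef_self_mul_conjTranspose (H * W))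
  have hV : R * Ustar = H * W :=
    mul_nonsing_inv_cancel_left _ _ ((isUnit_iff_isUnit_det _).mp hR.isUnit)
  refine ⟨hR, fun U => ?_⟩
  have hE : E U = E Ustar + (U - Ustar)ᴴ * R * (U - Ustar) := by
    have hH := hR.isHermitian
    rw [hR_eq] at hH hV ⊢
    exact mse_eq_add_of_normal_equation hH hV U
  have hD := hΨ.trace_mul_nonneg (hR.posSemidef.conjTranspose_mul_mul_same (U - Ustar))
  rw [hE, Matrix.mul_add Ψ (E Ustar), trace_add _ (Ψ * ((U - Ustar)ᴴ * R * (U - Ustar))),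
    Complex.add_re]
  exact le_add_of_nonneg_right (Complex.nonneg_iff.mp hD).1
end

section
/- Let H be an m×n complex matrix, W an n×l complex matrix, and σ > 0 a real. Let R = H·W·Wᴴ·Hᴴ + σ²·I_m (positive definite, hence invertible) and U* = R⁻¹·H·W, and define E(U) = (I_l − Uᴴ·H·W)·(I_l − Uᴴ·H·W)ᴴ + σ²·Uᴴ·U. Then E(U*) = I_l − Wᴴ·Hᴴ·R⁻¹·H·W. -/
open Matrix
open scoped ComplexOrder

theorem posDef_mul_conjTranspose_add_sq_smul_one {ι κ : Type*} [Fintype ι] [DecidableEq ι]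
    [Fintype κ] (G : Matrix ι κ ℂ) {σ : ℝ} (hσ : 0 < σ) :
    (G * Gᴴ + ((σ : ℂ) ^ 2) • (1 : Matrix ι ι ℂ)).PosDef := by
  have h : (0 : ℂ) < (σ : ℂ) ^ 2 := by exact_mod_cast pow_pos hσ 2
  exact Matrix.PosDef.posSemidef_add (Matrix.posSemidef_self_mul_conjTranspose G)
    (Matrix.PosDef.one.smul h)

/-- The error matrix of the receiver `S * G`, for any Hermitian `S` that satisfies
`S * (G * Gᴴ + c • 1) * S = S`. -/
theorem error_matrix_eq_of_isHermitian {ι κ : Type*} [Fintype ι] [DecidableEq ι]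
    [Fintype κ] [DecidableEq κ] (G : Matrix ι κ ℂ) (S : Matrix ι ι ℂ) (c : ℂ)
    (hS : S.IsHermitian) (h : S * (G * Gᴴ + c • (1 : Matrix ι ι ℂ)) * S = S) :
    (1 - (S * G)ᴴ * G) * (1 - (S * G)ᴴ * G)ᴴ + c • ((S * G)ᴴ * (S * G))
      = 1 - Gᴴ * S * G := by
  have key : Gᴴ * S * G * (Gᴴ * S * G) + c • (Gᴴ * S * (S * G)) = Gᴴ * S * G := by
    conv_rhs => rw [← h]
    simp only [Matrix.mul_add, Matrix.add_mul, Matrix.mul_smul, Matrix.smul_mul,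
      Matrix.mul_one, Matrix.mul_assoc]
  have hG : (Gᴴ * S * G)ᴴ = Gᴴ * S * G := by
    simp only [conjTranspose_mul, conjTranspose_conjTranspose, hS.eq, Matrix.mul_assoc]
  rw [conjTranspose_mul S G, hS.eq, conjTranspose_sub, conjTranspose_one, hG]
  calc
    _ = 1 - Gᴴ * S * G - Gᴴ * S * G
          + (Gᴴ * S * G * (Gᴴ * S * G) + c • (Gᴴ * S * (S * G))) := by noncomm_ring
    _ = 1 - Gᴴ * S * G := by rw [key]; abel

theorem mmse_matrix_at_optimal_receiver
    {m n l : ℕ} (H : Matrix (Fin m) (Fin n) ℂ) (W : Matrix (Fin n) (Fin l) ℂ)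
    (σ : ℝ) (hσ : 0 < σ) :
    let R : Matrix (Fin m) (Fin m) ℂ :=
      H * W * Wᴴ * Hᴴ + ((σ : ℂ) ^ 2) • (1 : Matrix (Fin m) (Fin m) ℂ)
    let Ustar : Matrix (Fin m) (Fin l) ℂ := R⁻¹ * (H * W)
    (1 - Ustarᴴ * (H * W)) * (1 - Ustarᴴ * (H * W))ᴴ
        + ((σ : ℂ) ^ 2) • (Ustarᴴ * Ustar)
      = 1 - Wᴴ * Hᴴ * R⁻¹ * (H * W) := by
  intro R Ustar
  have hR : R = H * W * (H * W)ᴴ + ((σ : ℂ) ^ 2) • (1 : Matrix (Fin m) (Fin m) ℂ) := by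
    simp only [R, conjTranspose_mul, Matrix.mul_assoc]
  have hpos : R.PosDef := hR ▸ posDef_mul_conjTranspose_add_sq_smul_one (H * W) hσ
  have hinv : R⁻¹ * R * R⁻¹ = R⁻¹ := by
    rw [Matrix.nonsing_inv_mul R ((Matrix.isUnit_iff_isUnit_det R).mp hpos.isUnit),
      Matrix.one_mul]
  rw [← conjTranspose_mul H W]
  exact error_matrix_eq_of_isHermitian (H * W) R⁻¹ _ hpos.isHermitian.inv (hR ▸ hinv)
end

section
/- Let H be an m×n complex matrix, W an n×l complex matrix, and σ > 0 a real. Let R = H·W·Wᴴ·Hᴴ + σ²·I_m (positive definite, hence invertible), U* = R⁻¹·H·W, and E(U*) = (I_l − U*ᴴ·H·W)·(I_l − U*ᴴ·H·W)ᴴ + σ²·U*ᴴ·U*. Then E(U*) = (I_l + σ⁻²·Wᴴ·Hᴴ·H·W)⁻¹, where I_l + σ⁻²·Wᴴ·Hᴴ·H·W is positive definite, hence invertible. -/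
open Matrix
open scoped ComplexOrder

section MMSE

variable {ι κ : Type*} [Fintype ι] [DecidableEq ι] [Fintype κ] [DecidableEq κ]

/-- The mean-square error matrix at a solution `U` of the normal equation
`(G * Gᴴ + s • 1) * U = G`. -/
theorem mse_eq_one_sub_of_normal_equation (G U : Matrix ι κ ℂ) (s : ℂ)
    (hU : (G * Gᴴ + s • (1 : Matrix ι ι ℂ)) * U = G) :
    (1 - Uᴴ * G) * (1 - Uᴴ * G)ᴴ + s • (Uᴴ * U) = 1 - Gᴴ * U := by
  have key : Uᴴ * G * (Gᴴ * U) + s • (Uᴴ * U) = Uᴴ * G := by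
    have h := congrArg (Uᴴ * ·) hU
    simpa [Matrix.add_mul, Matrix.mul_add, Matrix.mul_assoc] using h
  calc (1 - Uᴴ * G) * (1 - Uᴴ * G)ᴴ + s • (Uᴴ * U)
      = 1 - Gᴴ * U - Uᴴ * G + (Uᴴ * G * (Gᴴ * U) + s • (Uᴴ * U)) := by
        simp only [conjTranspose_sub, conjTranspose_one, conjTranspose_mul,
          conjTranspose_conjTranspose]
        noncomm_ring
    _ = 1 - Gᴴ * U := by rw [key]; abel

theorem inv_one_add_gram_of_normal_equation (G U : Matrix ι κ ℂ) {s : ℂ} (hs : s ≠ 0)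
    (hU : (G * Gᴴ + s • (1 : Matrix ι ι ℂ)) * U = G) :
    (1 + s⁻¹ • (Gᴴ * G))⁻¹ = 1 - Gᴴ * U := by
  apply inv_eq_right_inv
  have key : Gᴴ * G * (Gᴴ * U) + s • (Gᴴ * U) = Gᴴ * G := by
    have h := congrArg (Gᴴ * ·) hU
    simpa [Matrix.add_mul, Matrix.mul_add, Matrix.mul_assoc] using h
  have key' : s⁻¹ • (Gᴴ * G * (Gᴴ * U)) + Gᴴ * U = s⁻¹ • (Gᴴ * G) := by
    have h := congrArg (s⁻¹ • ·) key
    simpa [smul_smul, hs] using h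
  rw [Matrix.add_mul, Matrix.one_mul, Matrix.mul_sub, Matrix.mul_one, Matrix.smul_mul, ← key']
  abel

end MMSE

theorem mmse_matrix_inverse_form
    {m n l : ℕ} (H : Matrix (Fin m) (Fin n) ℂ) (W : Matrix (Fin n) (Fin l) ℂ)
    (σ : ℝ) (hσ : 0 < σ) :
    let R : Matrix (Fin m) (Fin m) ℂ :=
      H * W * Wᴴ * Hᴴ + ((σ : ℂ) ^ 2) • (1 : Matrix (Fin m) (Fin m) ℂ)
    let Ustar : Matrix (Fin m) (Fin l) ℂ := R⁻¹ * (H * W)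
    let Estar : Matrix (Fin l) (Fin l) ℂ :=
      (1 - Ustarᴴ * (H * W)) * (1 - Ustarᴴ * (H * W))ᴴ
        + ((σ : ℂ) ^ 2) • (Ustarᴴ * Ustar)
    (1 + (((σ : ℂ) ^ 2)⁻¹) • (Wᴴ * Hᴴ * (H * W))).PosDef ∧
      Estar = (1 + (((σ : ℂ) ^ 2)⁻¹) • (Wᴴ * Hᴴ * (H * W)))⁻¹ := by
  intro R Ustar Estar
  have hs : (0 : ℂ) < (σ : ℂ) ^ 2 := by exact_mod_cast pow_pos hσ 2
  have hR : R = H * W * (H * W)ᴴ + ((σ : ℂ) ^ 2) • (1 : Matrix (Fin m) (Fin m) ℂ) := by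
    simp only [R, conjTranspose_mul, Matrix.mul_assoc]
  have hRpos : R.PosDef := by
    rw [hR]
    exact (PosDef.one.smul hs).posSemidef_add (posSemidef_self_mul_conjTranspose _)
  have hU : (H * W * (H * W)ᴴ + ((σ : ℂ) ^ 2) • (1 : Matrix (Fin m) (Fin m) ℂ)) * Ustar
      = H * W := by
    rw [← hR]
    exact mul_nonsing_inv_cancel_left _ _ ((isUnit_iff_isUnit_det _).1 hRpos.isUnit)
  rw [← conjTranspose_mul H W]
  refine ⟨PosDef.one.add_posSemidef ((posSemidef_conjTranspose_mul_self _).smul ?_), ?_⟩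
  · exact (by exact_mod_cast (inv_pos.2 (pow_pos hσ 2)).le : (0 : ℂ) ≤ ((σ : ℂ) ^ 2)⁻¹)
  · rw [inv_one_add_gram_of_normal_equation _ _ hs.ne' hU]
    exact mse_eq_one_sub_of_normal_equation _ _ _ hU
end

section
/- Let E be an l×l positive definite Hermitian complex matrix. Then for every l×l positive definite Hermitian complex matrix Ψ, Re(Tr(Ψ·E)) − ln((det Ψ).re) ≥ l + ln((det E).re), and equality holds for Ψ = E⁻¹; i.e., Ψ = E⁻¹ minimizes Ψ ↦ Re(Tr(Ψ·E)) − ln(det Ψ) over positive definite Hermitian matrices. -/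
open Matrix
open scoped ComplexOrder

theorem Matrix.PosDef.ofReal_re_det {n : Type*} [Fintype n] [DecidableEq n]
    {A : Matrix n n ℂ} (hA : A.PosDef) : ((A.det.re : ℝ) : ℂ) = A.det :=
  (Complex.eq_re_of_ofReal_le hA.det_pos.le).symm

theorem Matrix.PosDef.re_det_pos {n : Type*} [Fintype n] [DecidableEq n]
    {A : Matrix n n ℂ} (hA : A.PosDef) : 0 < A.det.re :=
  (Complex.pos_iff.mp hA.det_pos).1

theorem Matrix.PosDef.card_add_log_det_le_trace {n : Type*} [Fintype n] [DecidableEq n]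
    {A : Matrix n n ℂ} (hA : A.PosDef) :
    (Fintype.card n : ℝ) + Real.log A.det.re ≤ A.trace.re := by
  have hdet : A.det.re = ∏ i, hA.1.eigenvalues i := by
    rw [hA.1.det_eq_prod_eigenvalues]
    norm_cast
  have htrace : A.trace.re = ∑ i, hA.1.eigenvalues i := by
    rw [hA.1.trace_eq_sum_eigenvalues]
    norm_cast
  rw [hdet, htrace, Real.log_prod fun i _ ↦ (hA.eigenvalues_pos i).ne',
    ← Finset.card_univ, Finset.cast_card, ← Finset.sum_add_distrib]
  gcongr with i
  linarith [Real.log_le_sub_one_of_pos (hA.eigenvalues_pos i)]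

theorem Matrix.PosDef.exists_isUnit_eq_conjTranspose_mul_self {n : Type*} [Fintype n]
    [DecidableEq n] {A : Matrix n n ℂ} (hA : A.PosDef) :
    ∃ B : Matrix n n ℂ, IsUnit B ∧ A = Bᴴ * B := by
  open scoped MatrixOrder in
  obtain ⟨B, hB⟩ := CStarAlgebra.nonneg_iff_eq_star_mul_self.mp hA.posSemidef.nonneg
  refine ⟨B, ?_, hB⟩
  have h := hA.isUnit
  rw [hB, isUnit_iff_isUnit_det, det_mul] at h
  exact (isUnit_iff_isUnit_det B).mpr (isUnit_of_mul_isUnit_right h)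

theorem Matrix.PosDef.card_add_log_det_add_log_det_le_trace_mul {n : Type*} [Fintype n]
    [DecidableEq n] {A B : Matrix n n ℂ} (hA : A.PosDef) (hB : B.PosDef) :
    (Fintype.card n : ℝ) + Real.log A.det.re + Real.log B.det.re ≤ (A * B).trace.re := by
  obtain ⟨C, hC, rfl⟩ := hB.exists_isUnit_eq_conjTranspose_mul_self
  have hCAC : (C * A * Cᴴ).PosDef :=
    hA.mul_mul_conjTranspose_same (vecMul_injective_of_isUnit hC)
  have hdet : (C * A * Cᴴ).det.re = A.det.re * (Cᴴ * C).det.re := by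
    have h : (C * A * Cᴴ).det = A.det * (Cᴴ * C).det := by
      simp only [det_mul]
      ring
    rw [h, ← hA.ofReal_re_det, Complex.re_ofReal_mul, Complex.ofReal_re]
  have htrace : (C * A * Cᴴ).trace = (A * (Cᴴ * C)).trace := by
    rw [Matrix.mul_assoc, trace_mul_comm, Matrix.mul_assoc]
  have h := hCAC.card_add_log_det_le_trace
  rw [hdet, htrace, Real.log_mul hA.re_det_pos.ne' hB.re_det_pos.ne'] at h
  linarith

theorem weight_matrix_optimal
    {l : ℕ} (E : Matrix (Fin l) (Fin l) ℂ) (hE : E.PosDef) :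
    (∀ Ψ : Matrix (Fin l) (Fin l) ℂ, Ψ.PosDef →
        (l : ℝ) + Real.log (E.det.re) ≤ (Ψ * E).trace.re - Real.log (Ψ.det.re)) ∧
    (E⁻¹ * E).trace.re - Real.log ((E⁻¹).det.re)
        = (l : ℝ) + Real.log (E.det.re) := by
  constructor
  · intro Ψ hΨ
    have h := hΨ.card_add_log_det_add_log_det_le_trace_mul hE
    rw [Fintype.card_fin] at h
    linarith
  · have hdet : E⁻¹.det.re = (E.det.re)⁻¹ := by
      rw [det_nonsing_inv, Ring.inverse_eq_inv', ← hE.ofReal_re_det, ← Complex.ofReal_inv,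
        Complex.ofReal_re, Complex.ofReal_re]
    rw [nonsing_inv_mul E ((isUnit_iff_isUnit_det E).mp hE.isUnit), hdet, Real.log_inv]
    simp
end

section
/- Let H_B be an m_B×m_A complex matrix, H_W an m_W×m_A complex matrix, U an m_B×l complex matrix, Ψ an l×l positive semidefinite Hermitian complex matrix, and μ > 0 a real. Set A = H_Bᴴ·U·Ψ·Uᴴ·H_B, P = H_Wᴴ·H_W, C = H_Bᴴ·U·Ψ, and for υ ≥ 0 let W*(υ) = (A + μ·I_{m_A} + υ·P)⁻¹·C (the matrix inverted is positive definite, hence invertible). Then the leaked power υ ↦ ‖H_W·W*(υ)‖_F² is nonincreasing: for all reals 0 ≤ υ₁ ≤ υ₂, ‖H_W·W*(υ₂)‖_F ≤ ‖H_W·W*(υ₁)‖_F. -/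
open Matrix
open scoped ComplexOrder

/-- Squared Frobenius norm of a complex matrix: `‖A‖_F² = Re (Tr (Aᴴ A))`. -/
noncomputable def frobSq {m n : ℕ} (A : Matrix (Fin m) (Fin n) ℂ) : ℝ :=
  (Aᴴ * A).trace.re

/-- Frobenius norm of a complex matrix. -/
noncomputable def frob {m n : ℕ} (A : Matrix (Fin m) (Fin n) ℂ) : ℝ :=
  Real.sqrt (frobSq A)

theorem frobSq_nonneg {m n : ℕ} (A : Matrix (Fin m) (Fin n) ℂ) : 0 ≤ frobSq A :=
  (Complex.nonneg_iff.mp (posSemidef_conjTranspose_mul_self A).trace_nonneg).1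

theorem frobSq_add {m n : ℕ} (E Y : Matrix (Fin m) (Fin n) ℂ) :
    frobSq (E + Y) = frobSq E + 2 * (Eᴴ * Y).trace.re + frobSq Y := by
  have h : (Yᴴ * E).trace.re = (Eᴴ * Y).trace.re := by
    have : Yᴴ * E = (Eᴴ * Y)ᴴ := by simp
    rw [this, trace_conjTranspose]
    simp
  simp only [frobSq, conjTranspose_add, Matrix.add_mul, Matrix.mul_add, trace_add,
    Complex.add_re, h]
  ring

/-- Enlarging the penalty `Hᴴ * H` in a positive definite linear system shrinks the image under
`H` of its solution. -/
theorem frobSq_mul_le_of_mul_eq {m n l : ℕ} {M : Matrix (Fin n) (Fin n) ℂ} (hM : M.PosSemidef)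
    (H : Matrix (Fin m) (Fin n) ℂ) {δ : ℝ} (hδ : 0 < δ) {X Y : Matrix (Fin n) (Fin l) ℂ}
    (h : M * X = (M + (δ : ℂ) • (Hᴴ * H)) * Y) :
    frobSq (H * Y) ≤ frobSq (H * X) := by
  have hD : M * (X - Y) = (δ : ℂ) • (Hᴴ * H * Y) := by
    rw [Matrix.mul_sub, h, Matrix.add_mul, add_sub_cancel_left, Matrix.smul_mul]
  have hpos := (Complex.nonneg_iff.mp
    (hM.conjTranspose_mul_mul_same (X - Y)).trace_nonneg).1
  have hE : (X - Y)ᴴ * M * (X - Y) = (δ : ℂ) • ((H * (X - Y))ᴴ * (H * Y)) := by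
    rw [Matrix.mul_assoc, hD, Matrix.mul_smul, conjTranspose_mul]
    simp only [Matrix.mul_assoc]
  rw [hE, trace_smul, smul_eq_mul, Complex.re_ofReal_mul] at hpos
  have hcross := nonneg_of_mul_nonneg_right hpos hδ
  have hX : H * X = H * (X - Y) + H * Y := by rw [← Matrix.mul_add, sub_add_cancel]
  rw [hX, frobSq_add]
  linarith [frobSq_nonneg (H * (X - Y))]

theorem leaked_power_antitone_in_dual_variable
    {mB mW mA l : ℕ}
    (HB : Matrix (Fin mB) (Fin mA) ℂ) (HW : Matrix (Fin mW) (Fin mA) ℂ)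
    (U : Matrix (Fin mB) (Fin l) ℂ)
    (Ψ : Matrix (Fin l) (Fin l) ℂ) (hΨ : Ψ.PosSemidef)
    (μ : ℝ) (hμ : 0 < μ) :
    let A : Matrix (Fin mA) (Fin mA) ℂ := HBᴴ * U * Ψ * Uᴴ * HB
    let P : Matrix (Fin mA) (Fin mA) ℂ := HWᴴ * HW
    let C : Matrix (Fin mA) (Fin l) ℂ := HBᴴ * U * Ψ
    let Wstar : ℝ → Matrix (Fin mA) (Fin l) ℂ := fun υ =>
      (A + (μ : ℂ) • (1 : Matrix (Fin mA) (Fin mA) ℂ) + (υ : ℂ) • P)⁻¹ * C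
    (∀ υ : ℝ, 0 ≤ υ →
        (A + (μ : ℂ) • (1 : Matrix (Fin mA) (Fin mA) ℂ) + (υ : ℂ) • P).PosDef) ∧
      ∀ υ₁ υ₂ : ℝ, 0 ≤ υ₁ → υ₁ ≤ υ₂ →
        frob (HW * Wstar υ₂) ≤ frob (HW * Wstar υ₁) := by
  intro A P C Wstar
  have hA : A.PosSemidef := by
    have h := hΨ.conjTranspose_mul_mul_same (Uᴴ * HB)
    simpa only [A, conjTranspose_mul, conjTranspose_conjTranspose, Matrix.mul_assoc] using h
  have hpd : ∀ υ : ℝ, 0 ≤ υ →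
      (A + (μ : ℂ) • (1 : Matrix (Fin mA) (Fin mA) ℂ) + (υ : ℂ) • P).PosDef := fun υ hυ =>
    (PosDef.posSemidef_add hA (PosDef.one.smul (Complex.zero_lt_real.mpr hμ))).add_posSemidef
      ((posSemidef_conjTranspose_mul_self HW).smul (Complex.zero_le_real.mpr hυ))
  have hsol : ∀ υ : ℝ, 0 ≤ υ →
      (A + (μ : ℂ) • (1 : Matrix (Fin mA) (Fin mA) ℂ) + (υ : ℂ) • P) * Wstar υ = C :=
    fun υ hυ => mul_nonsing_inv_cancel_left _ _
      ((Matrix.isUnit_iff_isUnit_det _).mp (hpd υ hυ).isUnit)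
  refine ⟨hpd, fun υ₁ υ₂ h₁ h₁₂ => ?_⟩
  rcases h₁₂.eq_or_lt with rfl | hlt
  · exact le_rfl
  refine Real.sqrt_le_sqrt
    (frobSq_mul_le_of_mul_eq (hpd υ₁ h₁).posSemidef HW (sub_pos.mpr hlt) ?_)
  rw [hsol υ₁ h₁, ← hsol υ₂ (h₁.trans h₁₂)]
  congr 1
  rw [add_assoc _ ((υ₁ : ℂ) • P), ← add_smul]
  simp
end

section
/- Let N be a natural number and M an N×N complex matrix. Suppose that for all vectors x, y : Fin N → ℂ satisfying Σ_n conj(x_n)·y_n = 0 (i.e., x and y are orthogonal) one has Σ_{i,j} conj(x_i)·M_{i,j}·y_j = 0. Then there exists ν ∈ ℂ such that M = ν·I_N; i.e., a matrix whose quadratic form vanishes on all orthogonal pairs is a scalar multiple of the identity. -/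
theorem vanishing_on_orthogonal_pairs_implies_scalar
    {N : ℕ} (M : Matrix (Fin N) (Fin N) ℂ)
    (h : ∀ x y : Fin N → ℂ, (∑ n, (starRingEnd ℂ) (x n) * y n) = 0 →
        (∑ i, ∑ j, (starRingEnd ℂ) (x i) * M i j * y j) = 0) :
    ∃ ν : ℂ, M = ν • (1 : Matrix (Fin N) (Fin N) ℂ) := by
  have off_diag : ∀ i j, i ≠ j → M i j = 0 := by
    intro i j hij
    have := h (fun n => if n = i then 1 else 0) (fun n => if n = j then 1 else 0)
      (by simp [apply_ite (starRingEnd ℂ), hij.symm])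
    simpa [apply_ite (starRingEnd ℂ)] using this
  have diag : ∀ i j, M i i = M j j := by
    intro i j
    by_cases hij : i = j
    · rw [hij]
    have := h (fun n => (if n = i then 1 else 0) + (if n = j then 1 else 0))
      (fun n => (if n = i then 1 else 0) - (if n = j then 1 else 0))
      (by simp [apply_ite (starRingEnd ℂ), mul_sub,
            hij, Ne.symm hij])
    simp [apply_ite (starRingEnd ℂ), add_mul, mul_sub, Finset.sum_add_distrib,
      off_diag i j hij, off_diag j i (Ne.symm hij)] at this
    linear_combination this
  rcases isEmpty_or_nonempty (Fin N) with _ | ⟨⟨k⟩⟩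
  · exact ⟨0, Subsingleton.elim _ _⟩
  · refine ⟨M k k, ?_⟩
    ext i j
    by_cases hij : i = j
    · subst hij
      simp [diag i k]
    · simp [off_diag i j hij, hij]
end

section
/- Let H be an m×n complex matrix, W an n×l complex matrix, and σ > 0 a real. Let R = H·W·Wᴴ·Hᴴ + σ²·I_m (positive definite, hence invertible), U* = R⁻¹·H·W, and E(U*) = (I_l − U*ᴴ·H·W)·(I_l − U*ᴴ·H·W)ᴴ + σ²·U*ᴴ·U*. Then det(I_m + σ⁻²·H·W·Wᴴ·Hᴴ) · det(E(U*)) = 1; equivalently, the achievable rate log det(I_m + σ⁻²·H·W·Wᴴ·Hᴴ) equals −log det(E(U*)), which is the rate–MSE equivalence underlying the WMMSE transformation. -/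
open Matrix

open scoped ComplexOrder in
/-- The regularized Gram matrix `G Gᴴ + σ² I` is Hermitian and invertible for `σ > 0`. -/
theorem isHermitian_and_isUnit_det_mul_conjTranspose_add_smul_one {m l : ℕ}
    (G : Matrix (Fin m) (Fin l) ℂ) {σ : ℝ} (hσ : 0 < σ) :
    (G * Gᴴ + ((σ : ℂ) ^ 2) • (1 : Matrix (Fin m) (Fin m) ℂ)).IsHermitian ∧
      IsUnit (G * Gᴴ + ((σ : ℂ) ^ 2) • (1 : Matrix (Fin m) (Fin m) ℂ)).det := by
  have hc : (0 : ℂ) < (σ : ℂ) ^ 2 := by exact_mod_cast pow_pos hσ 2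
  have hpos : (G * Gᴴ + ((σ : ℂ) ^ 2) • (1 : Matrix (Fin m) (Fin m) ℂ)).PosDef :=
    PosDef.posSemidef_add (posSemidef_self_mul_conjTranspose G) (PosDef.one.smul hc)
  exact ⟨hpos.isHermitian, hpos.det_pos.ne'.isUnit⟩

/-- At the MMSE receiver `U = R⁻¹ G`, where `R = G Gᴴ + c I`, the error covariance
collapses to `1 - Uᴴ G`. -/
theorem mmse_error_eq_one_sub {m l : ℕ} (G : Matrix (Fin m) (Fin l) ℂ) (c : ℂ)
    {R : Matrix (Fin m) (Fin m) ℂ} (hR : R = G * Gᴴ + c • 1) (hRh : R.IsHermitian)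
    (hdet : IsUnit R.det) :
    (1 - (R⁻¹ * G)ᴴ * G) * (1 - (R⁻¹ * G)ᴴ * G)ᴴ + c • ((R⁻¹ * G)ᴴ * (R⁻¹ * G)) =
      1 - Gᴴ * (R⁻¹ * G) := by
  have hU : (R⁻¹ * G)ᴴ = Gᴴ * R⁻¹ := by rw [conjTranspose_mul, hRh.inv.eq]
  have hmul : R * (R⁻¹ * G) = G := mul_nonsing_inv_cancel_left R G hdet
  have hK : Gᴴ * R⁻¹ * G * (Gᴴ * (R⁻¹ * G)) + c • (Gᴴ * R⁻¹ * (R⁻¹ * G)) =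
      Gᴴ * (R⁻¹ * G) :=
    calc _ = Gᴴ * R⁻¹ * ((G * Gᴴ + c • 1) * (R⁻¹ * G)) := by
          simp [Matrix.add_mul, Matrix.mul_add, Matrix.mul_assoc]
      _ = _ := by rw [← hR, hmul, Matrix.mul_assoc]
  have hKh : (1 - Gᴴ * R⁻¹ * G)ᴴ = 1 - Gᴴ * (R⁻¹ * G) := by
    rw [conjTranspose_sub, conjTranspose_one, conjTranspose_mul, conjTranspose_mul,
      hRh.inv.eq, conjTranspose_conjTranspose]
  rw [hU, hKh, Matrix.sub_mul, Matrix.one_mul, Matrix.mul_sub, Matrix.mul_one,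
    eq_sub_of_add_eq' hK, Matrix.mul_assoc Gᴴ R⁻¹ G]
  abel

theorem rate_mse_determinant_identity
    {m n l : ℕ} (H : Matrix (Fin m) (Fin n) ℂ) (W : Matrix (Fin n) (Fin l) ℂ)
    (σ : ℝ) (hσ : 0 < σ) :
    let R : Matrix (Fin m) (Fin m) ℂ :=
      H * W * Wᴴ * Hᴴ + ((σ : ℂ) ^ 2) • (1 : Matrix (Fin m) (Fin m) ℂ)
    let Ustar : Matrix (Fin m) (Fin l) ℂ := R⁻¹ * (H * W)
    let Estar : Matrix (Fin l) (Fin l) ℂ :=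
      (1 - Ustarᴴ * (H * W)) * (1 - Ustarᴴ * (H * W))ᴴ
        + ((σ : ℂ) ^ 2) • (Ustarᴴ * Ustar)
    ((1 : Matrix (Fin m) (Fin m) ℂ)
        + (((σ : ℂ) ^ 2)⁻¹) • (H * W * Wᴴ * Hᴴ)).det * Estar.det = 1 := by
  intro R Ustar Estar
  have hc : (σ : ℂ) ^ 2 ≠ 0 := by exact_mod_cast (pow_pos hσ 2).ne'
  have hG : H * W * Wᴴ * Hᴴ = H * W * (H * W)ᴴ := by
    rw [conjTranspose_mul, ← Matrix.mul_assoc]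
  have hR : R = H * W * (H * W)ᴴ + ((σ : ℂ) ^ 2) • 1 := by rw [← hG]
  obtain ⟨hRh, hdet⟩ : R.IsHermitian ∧ IsUnit R.det :=
    hR ▸ isHermitian_and_isUnit_det_mul_conjTranspose_add_smul_one (H * W) hσ
  have hE : Estar = 1 - (H * W)ᴴ * (R⁻¹ * (H * W)) :=
    mmse_error_eq_one_sub (H * W) _ hR hRh hdet
  have hcomplement : 1 - R⁻¹ * (H * W) * (H * W)ᴴ = ((σ : ℂ) ^ 2) • R⁻¹ := by
    rw [Matrix.mul_assoc, ← nonsing_inv_mul R hdet, ← Matrix.mul_sub]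
    nth_rw 2 [hR]
    rw [add_sub_cancel_left, Matrix.mul_smul, Matrix.mul_one]
  have hrate : 1 + ((σ : ℂ) ^ 2)⁻¹ • (H * W * Wᴴ * Hᴴ) = ((σ : ℂ) ^ 2)⁻¹ • R := by
    rw [smul_add, inv_smul_smul₀ hc, add_comm]
  rw [hE, det_one_sub_mul_comm, hcomplement, hrate, ← det_mul, smul_mul_smul_comm,
    inv_mul_cancel₀ hc, mul_nonsing_inv R hdet, one_smul, det_one]
end
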